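/- arXiv:math-ph/0501033 — 7 statements merged into one kernel-verified Lean document; each statement's English description precedes it below -/
import Mathlib

section
/- Let H be a complex Hilbert space and η a bounded self-adjoint operator on H. Let |η| denote the positive square root of η² given by the continuous functional calculus. Then for all x, y ∈ H: |⟪x, η y⟫|² ≤ re⟪x, |η| x⟫ · re⟪y, |η| y⟫. -/
open scoped InnerProductSpace

lemma pos_sqrt_inner {H : Type*} [NormedAddCommGroup H] [InnerProductSpace ℂ H] [CompleteSpace H]
    (P : H →L[ℂ] H) (hP : 0 ≤ P) :
    ∃ p : H →L[ℂ] H, ∀ x y : H, ⟪x, P y⟫_ℂ = ⟪p x, p y⟫_ℂ := by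
  refine ⟨CFC.sqrt P, fun x y => ?_⟩
  have h0 : 0 ≤ CFC.sqrt P := CFC.sqrt_nonneg P
  have hs : IsSelfAdjoint (CFC.sqrt P) := IsSelfAdjoint.of_nonneg h0
  have h1 : CFC.sqrt P * CFC.sqrt P = P := CFC.sqrt_mul_sqrt_self P hP
  have h2 : P y = CFC.sqrt P (CFC.sqrt P y) := by
    conv_lhs => rw [← h1]
    rfl
  rw [h2, ← ContinuousLinearMap.adjoint_inner_left, hs.adjoint_eq]

/-- Generalized Cauchy–Schwarz inequality: for a bounded self-adjoint operator `η` on a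
complex Hilbert space, with `|η|` the positive square root of `η²`, one has
`|⟪x, η y⟫|² ≤ re⟪x, |η| x⟫ · re⟪y, |η| y⟫`; i.e. the scalar product `⟪·,|η|·⟫`
dominates the indefinite inner product `⟪·,η·⟫`. -/
theorem stmt_4 {H : Type*} [NormedAddCommGroup H] [InnerProductSpace ℂ H] [CompleteSpace H]
    (η absη : H →L[ℂ] H) (hη : IsSelfAdjoint η)
    (habs_pos : absη.IsPositive) (habs_sq : absη * absη = η * η) :
    ∀ x y : H, ‖⟪x, η y⟫_ℂ‖ ^ 2 ≤ (⟪x, absη x⟫_ℂ).re * (⟪y, absη y⟫_ℂ).re := by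
  intro x y
  have h0 : 0 ≤ absη := (ContinuousLinearMap.nonneg_iff_isPositive absη).2 habs_pos
  have hA : absη = CFC.abs η := by
    rw [CFC.abs, hη.star_eq, ← habs_sq, CFC.sqrt_mul_self absη h0]
  have hadd : absη = η⁺ + η⁻ := by rw [hA, CFC.posPart_add_negPart η hη]
  have hsub : η = η⁺ - η⁻ := (CFC.posPart_sub_negPart η hη).symm
  obtain ⟨p, hp⟩ := pos_sqrt_inner (η⁺) (CFC.posPart_nonneg η)
  obtain ⟨n, hn⟩ := pos_sqrt_inner (η⁻) (CFC.negPart_nonneg η)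
  have hq : ∀ z : H, (⟪z, absη z⟫_ℂ).re = ‖p z‖ ^ 2 + ‖n z‖ ^ 2 := by
    intro z
    rw [hadd, ContinuousLinearMap.add_apply, inner_add_right, hp, hn, Complex.add_re,
      inner_self_eq_norm_sq_to_K, inner_self_eq_norm_sq_to_K]
    norm_cast
  have hxy : ⟪x, η y⟫_ℂ = ⟪p x, p y⟫_ℂ - ⟪n x, n y⟫_ℂ := by
    rw [← hp, ← hn, ← inner_sub_right, ← ContinuousLinearMap.sub_apply, ← hsub]
  have hb : ‖⟪x, η y⟫_ℂ‖ ≤ ‖p x‖ * ‖p y‖ + ‖n x‖ * ‖n y‖ := by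
    rw [hxy]
    exact (norm_sub_le _ _).trans (add_le_add (norm_inner_le_norm _ _) (norm_inner_le_norm _ _))
  rw [hq, hq]
  calc _ ≤ (‖p x‖ * ‖p y‖ + ‖n x‖ * ‖n y‖) ^ 2 := by gcongr
    _ ≤ _ := by nlinarith [sq_nonneg (‖p x‖ * ‖n y‖ - ‖n x‖ * ‖p y‖)]
end

section
/- Let H be a complex Hilbert space and η a bounded self-adjoint operator on H with ‖η‖ ≤ 1 (a self-adjoint contraction). Let P₀ be the orthogonal projection onto the kernel of η. Then for all x, y ∈ H: |⟪x, η y⟫|² ≤ re⟪x, (1 − P₀) x⟫ · re⟪y, (1 − P₀) y⟫. -/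
open scoped InnerProductSpace

/-- For a self-adjoint contraction `η` on a complex Hilbert space and `P₀` the orthogonal
projection onto `ker η`, the degenerate scalar product `⟪·,(1−P₀)·⟫` still dominates the
indefinite inner product: `|⟪x, η y⟫|² ≤ re⟪x,(1−P₀)x⟫ · re⟪y,(1−P₀)y⟫`. -/
theorem stmt_5 {H : Type*} [NormedAddCommGroup H] [InnerProductSpace ℂ H] [CompleteSpace H]
    (η P₀ : H →L[ℂ] H) (hη : IsSelfAdjoint η) (hcontr : ‖η‖ ≤ 1)
    (hP_sa : IsSelfAdjoint P₀) (hP_idem : P₀ * P₀ = P₀)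
    (hP_range : ∀ x : H, η (P₀ x) = 0)
    (hP_fix : ∀ x : H, η x = 0 → P₀ x = x) :
    ∀ x y : H, ‖⟪x, η y⟫_ℂ‖ ^ 2 ≤ (⟪x, (1 - P₀) x⟫_ℂ).re * (⟪y, (1 - P₀) y⟫_ℂ).re := by
  intro x y
  have hs : ∀ u v : H, ⟪η u, v⟫_ℂ = ⟪u, η v⟫_ℂ := fun u v => hη.isSymmetric u v
  have hPs : ∀ u v : H, ⟪P₀ u, v⟫_ℂ = ⟪u, P₀ v⟫_ℂ := fun u v => hP_sa.isSymmetric u v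
  have hPP : ∀ u : H, P₀ (P₀ u) = P₀ u := fun u => congrArg (fun T : H →L[ℂ] H => T u) hP_idem
  have key : ∀ u : H, (⟪u, (1 - P₀) u⟫_ℂ).re = ‖u - P₀ u‖ ^ 2 := by
    intro u
    have h0 : ⟪P₀ u, u - P₀ u⟫_ℂ = 0 := by
      rw [hPs, map_sub, hPP, sub_self, inner_zero_right]
    have h1 : ⟪u, (1 - P₀) u⟫_ℂ = ⟪u - P₀ u, u - P₀ u⟫_ℂ := by
      rw [inner_sub_left u (P₀ u) (u - P₀ u), h0, sub_zero]
      rfl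
    rw [h1, inner_self_eq_norm_sq_to_K]
    norm_cast
  have e : ⟪x, η y⟫_ℂ = ⟪x - P₀ x, η (y - P₀ y)⟫_ℂ := by
    rw [map_sub, hP_range, sub_zero, inner_sub_left, ← hs (P₀ x), hP_range, inner_zero_left,
      sub_zero]
  have b : ‖⟪x, η y⟫_ℂ‖ ≤ ‖x - P₀ x‖ * ‖y - P₀ y‖ := by
    rw [e]
    refine (norm_inner_le_norm _ _).trans ?_
    gcongr
    exact (η.le_of_opNorm_le hcontr _).trans (by rw [one_mul])
  rw [key, key, ← mul_pow]
  gcongr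
end

section
/- Let H be a complex Hilbert space and η a bounded self-adjoint operator on H which is invertible with bounded inverse, and set B(x,y) := ⟪x, η y⟫. Suppose S : H × H → ℂ is a positive semidefinite Hermitean sesquilinear form such that (i) there is C₁ ≥ 0 with S(x,x) ≤ C₁‖x‖² for all x, and (ii) there is C₂ ≥ 0 with |B(x,y)|² ≤ C₂·S(x,x)·S(y,y) for all x,y (admissibility). Then there exists c > 0 such that c‖x‖² ≤ S(x,x) for all x ∈ H; that is, the norm induced by S is equivalent to the original Hilbert norm. -/
open scoped InnerProductSpace ComplexConjugate

/-- Maximality (Morchio–Strocchi): if the metric operator `η` of the indefinite inner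
product `B(x,y) = ⟪x, η y⟫` is invertible with bounded inverse, then any admissible
positive semidefinite Hermitean sesquilinear form `S` dominated by the Hilbert norm and
dominating `B` in the Cauchy–Schwarz sense is itself bounded below: the topology of `S`
is equivalent to the original Hilbert topology. -/
theorem stmt_7 {H : Type*} [NormedAddCommGroup H] [InnerProductSpace ℂ H] [CompleteSpace H]
    (η ηinv : H →L[ℂ] H) (hη : IsSelfAdjoint η)
    (hinv₁ : η * ηinv = 1) (hinv₂ : ηinv * η = 1)
    (S : H → H → ℂ)
    (hadd₁ : ∀ x x' y : H, S (x + x') y = S x y + S x' y)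
    (hsmul₁ : ∀ (c : ℂ) (x y : H), S (c • x) y = conj c * S x y)
    (hadd₂ : ∀ x y y' : H, S x (y + y') = S x y + S x y')
    (hsmul₂ : ∀ (c : ℂ) (x y : H), S x (c • y) = c * S x y)
    (hherm : ∀ x y : H, S x y = conj (S y x))
    (hpos : ∀ x : H, 0 ≤ (S x x).re)
    (C₁ : ℝ) (hC₁ : 0 ≤ C₁) (hdom : ∀ x : H, (S x x).re ≤ C₁ * ‖x‖ ^ 2)
    (C₂ : ℝ) (hC₂ : 0 ≤ C₂)
    (hadm : ∀ x y : H, ‖⟪x, η y⟫_ℂ‖ ^ 2 ≤ C₂ * (S x x).re * (S y y).re) :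
    ∃ c : ℝ, 0 < c ∧ ∀ x : H, c * ‖x‖ ^ 2 ≤ (S x x).re := by
  set K : ℝ := C₂ * (C₁ * ‖ηinv‖ ^ 2) with hK
  have hK0 : 0 ≤ K := by positivity
  refine ⟨1 / (K + 1), by positivity, fun x => ?_⟩
  have hs := hpos x
  have key : ‖x‖ ^ 2 ≤ K * (S x x).re := by
    by_cases hx : x = 0
    · subst hx
      have h0 : 0 ≤ K * (S (0 : H) 0).re := mul_nonneg hK0 hs
      simpa using h0
    have hx2 : 0 < ‖x‖ ^ 2 := by
      have := norm_pos_iff.mpr hx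
      positivity
    have h1 : η (ηinv x) = x := by
      have := congrArg (fun T : H →L[ℂ] H => T x) hinv₁
      simpa using this
    have h2 := hadm x (ηinv x)
    rw [h1, inner_self_eq_norm_sq_to_K] at h2
    have h3 : ‖((‖x‖ : ℂ)) ^ 2‖ = ‖x‖ ^ 2 := by
      rw [norm_pow, Complex.norm_real, norm_norm]
    have h4 : (‖x‖ ^ 2) ^ 2 ≤ C₂ * (S x x).re * (S (ηinv x) (ηinv x)).re := by
      rw [← h3]
      exact h2
    have h5 : ‖ηinv x‖ ^ 2 ≤ ‖ηinv‖ ^ 2 * ‖x‖ ^ 2 := by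
      rw [← mul_pow]
      exact pow_le_pow_left₀ (norm_nonneg _) (ηinv.le_opNorm x) 2
    have h6 : (S (ηinv x) (ηinv x)).re ≤ C₁ * (‖ηinv‖ ^ 2 * ‖x‖ ^ 2) :=
      (hdom _).trans (mul_le_mul_of_nonneg_left h5 hC₁)
    have h7 := h4.trans (mul_le_mul_of_nonneg_left h6 (mul_nonneg hC₂ hs))
    refine le_of_mul_le_mul_right ?_ hx2
    calc ‖x‖ ^ 2 * ‖x‖ ^ 2 = (‖x‖ ^ 2) ^ 2 := by ring
      _ ≤ _ := h7
      _ = K * (S x x).re * ‖x‖ ^ 2 := by rw [hK]; ring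
  rw [one_div, inv_mul_le_iff₀ (by positivity)]
  linarith
end

section
/- Let H be a complex Hilbert space and η a bounded self-adjoint injective operator on H which is NOT bounded below, i.e. there is no c > 0 with c‖x‖ ≤ ‖ηx‖ for all x. Let |η| be the positive square root of η² given by the continuous functional calculus, and define S(x,y) := ⟪x, |η| y⟫. Then: (i) S is a positive definite Hermitean sesquilinear form on H (an inner product); (ii) |⟪x, η y⟫|² ≤ S(x,x)·S(y,y) for all x,y (admissibility); (iii) there is no c > 0 with c‖x‖² ≤ S(x,x) for all x, i.e. the topology induced by S is strictly weaker than the original Hilbert topology. -/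
open scoped InnerProductSpace ComplexConjugate

/-- A positive operator factors as `⟪x, T y⟫ = ⟪R x, R y⟫`, `T = R * R`. -/
lemma aux_factor {H : Type*} [NormedAddCommGroup H] [InnerProductSpace ℂ H] [CompleteSpace H]
    (T : H →L[ℂ] H) (hT : 0 ≤ T) :
    ∃ R : H →L[ℂ] H, R * R = T ∧ ∀ x y : H, ⟪x, T y⟫_ℂ = ⟪R x, R y⟫_ℂ := by
  have h1 : CFC.sqrt T * CFC.sqrt T = T := CFC.sqrt_mul_sqrt_self T hT
  have h2 : IsSelfAdjoint (CFC.sqrt T) := IsSelfAdjoint.of_nonneg (CFC.sqrt_nonneg T)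
  refine ⟨CFC.sqrt T, h1, fun x y => ?_⟩
  have h3 := (ContinuousLinearMap.isSelfAdjoint_iff_isSymmetric.mp h2) x (CFC.sqrt T y)
  have h4 : T y = CFC.sqrt T (CFC.sqrt T y) := by
    conv_lhs => rw [← h1]
    rfl
  rw [h4]
  exact h3.symm

lemma aux_real (a b c d : ℝ) :
    (a * b + c * d) ^ 2 ≤ (a ^ 2 + c ^ 2) * (b ^ 2 + d ^ 2) := by
  nlinarith [sq_nonneg (a * d - b * c)]

lemma aux_self {H : Type*} [NormedAddCommGroup H] [InnerProductSpace ℂ H] (x : H) :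
    (⟪x, x⟫_ℂ).re = ‖x‖ ^ 2 := by
  have := inner_self_eq_norm_sq (𝕜 := ℂ) x
  simpa using this

/-- Non-maximality (converse direction of Morchio–Strocchi): if the self-adjoint
injective metric operator `η` is not bounded below (no continuous inverse), then
`S(x,y) = ⟪x, |η| y⟫` is a positive definite Hermitean inner product which is admissible
(`|⟪x,ηy⟫|² ≤ S(x,x)S(y,y)`) but induces a strictly weaker topology than the Hilbert one. -/
theorem stmt_8 {H : Type*} [NormedAddCommGroup H] [InnerProductSpace ℂ H] [CompleteSpace H]
    (η : H →L[ℂ] H) (hη : IsSelfAdjoint η)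
    (hinj : Function.Injective η)
    (hnb : ¬ ∃ c : ℝ, 0 < c ∧ ∀ x : H, c * ‖x‖ ≤ ‖η x‖)
    (absη : H →L[ℂ] H) (habs_pos : absη.IsPositive) (habs_sq : absη * absη = η * η)
    (S : H → H → ℂ) (hS : ∀ x y : H, S x y = ⟪x, absη y⟫_ℂ) :
    (∀ x y : H, S x y = conj (S y x)) ∧
    (∀ x : H, x ≠ 0 → 0 < (S x x).re) ∧
    (∀ x y : H, ‖⟪x, η y⟫_ℂ‖ ^ 2 ≤ (S x x).re * (S y y).re) ∧
    ¬ ∃ c : ℝ, 0 < c ∧ ∀ x : H, c * ‖x‖ ^ 2 ≤ (S x x).re := by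
  have hsym := ContinuousLinearMap.isSelfAdjoint_iff_isSymmetric.mp hη
  have hasym : ∀ x y : H, ⟪absη x, y⟫_ℂ = ⟪x, absη y⟫_ℂ :=
    ContinuousLinearMap.isSelfAdjoint_iff_isSymmetric.mp habs_pos.isSelfAdjoint
  have h0 : 0 ≤ absη := (ContinuousLinearMap.nonneg_iff_isPositive absη).mpr habs_pos
  have happ : ∀ x, absη (absη x) = η (η x) := fun x => congrArg (fun T => T x) habs_sq
  have hnorm : ∀ x, ‖absη x‖ = ‖η x‖ := by
    intro x
    have h : ⟪absη x, absη x⟫_ℂ = ⟪η x, η x⟫_ℂ := by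
      rw [hasym, happ]
      exact (hsym x (η x)).symm
    have h' : ‖absη x‖ ^ 2 = ‖η x‖ ^ 2 := by rw [← aux_self, ← aux_self, h]
    exact (sq_eq_sq₀ (norm_nonneg _) (norm_nonneg _)).mp h'
  have habs : absη = CFC.abs η := by
    rw [CFC.abs, hη.star_eq, ← habs_sq]
    exact (CFC.sqrt_mul_self absη h0).symm
  refine ⟨?_, ?_, ?_, ?_⟩
  · intro x y
    rw [hS, hS, inner_conj_symm, hasym]
  · intro x hx
    obtain ⟨R, hR, hRi⟩ := aux_factor absη h0
    rw [hS, hRi, aux_self]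
    have : R x ≠ 0 := by
      intro hz
      apply hx
      have ha : absη x = 0 := by
        rw [← hR]
        change R (R x) = 0
        rw [hz, map_zero]
      have hb : ‖η x‖ = 0 := by rw [← hnorm, ha, norm_zero]
      exact hinj (by rw [norm_eq_zero.mp hb, map_zero])
    positivity
  · intro x y
    obtain ⟨P, -, hP⟩ := aux_factor (η⁺) (CFC.posPart_nonneg η)
    obtain ⟨N, -, hN⟩ := aux_factor (η⁻) (CFC.negPart_nonneg η)
    have e1 : η⁺ - η⁻ = η := CFC.posPart_sub_negPart η hη
    have e2 : η⁺ + η⁻ = absη := by rw [habs]; exact CFC.posPart_add_negPart η hη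
    have f1 : ⟪x, η y⟫_ℂ = ⟪P x, P y⟫_ℂ - ⟪N x, N y⟫_ℂ := by
      conv_lhs => rw [← e1]
      rw [ContinuousLinearMap.sub_apply, inner_sub_right, hP, hN]
    have f2 : ∀ z, (S z z).re = ‖P z‖ ^ 2 + ‖N z‖ ^ 2 := by
      intro z
      rw [hS, ← e2, ContinuousLinearMap.add_apply, inner_add_right, hP, hN, Complex.add_re,
        aux_self, aux_self]
    rw [f2, f2, f1]
    refine le_trans ?_ (aux_real ‖P x‖ ‖P y‖ ‖N x‖ ‖N y‖)
    gcongr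
    exact (norm_sub_le _ _).trans (add_le_add (norm_inner_le_norm _ _) (norm_inner_le_norm _ _))
  · rintro ⟨c, hc, h⟩
    refine hnb ⟨c, hc, fun x => ?_⟩
    have h1 := h x
    have h2 : (S x x).re ≤ ‖x‖ * ‖η x‖ := by
      rw [hS, ← hnorm]
      exact (Complex.re_le_norm _).trans (norm_inner_le_norm _ _)
    rcases eq_or_ne x 0 with rfl | hx
    · simp
    · have hp : 0 < ‖x‖ := norm_pos_iff.mpr hx
      refine le_of_mul_le_mul_left ?_ hp
      nlinarith
end

section
/- Let H be a complex Hilbert space and η a bounded self-adjoint operator on H which is invertible with bounded inverse. Let |η| be the positive square root of η² given by the continuous functional calculus, define S(x,y) := ⟪x, |η| y⟫ and u := |η|⁻¹ ∘ η. Then: (i) there exist constants c, C > 0 with c‖x‖² ≤ S(x,x) ≤ C‖x‖² for all x, so S is an inner product inducing the same topology as ⟪·,·⟫; (ii) ⟪x, η y⟫ = S(x, u y) for all x,y, and S(u x, y) = S(x, u y) for all x,y (u is S-self-adjoint); (iii) u ∘ u = 1. -/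
open scoped InnerProductSpace

/-- Second assertion of Theorem 3.1 (Morchio–Strocchi): for an invertible self-adjoint
metric operator `η`, the scalar product `S(x,y) = ⟪x, |η| y⟫` is equivalent to the
original one, represents the indefinite inner product via `u = |η|⁻¹ ∘ η`
(`⟪x, η y⟫ = S(x, u y)`, `u` S-self-adjoint), and `u` satisfies the Krein relation
`u² = 1`. -/
theorem stmt_9 {H : Type*} [NormedAddCommGroup H] [InnerProductSpace ℂ H] [CompleteSpace H]
    (η ηinv : H →L[ℂ] H) (hη : IsSelfAdjoint η)
    (hinv₁ : η * ηinv = 1) (hinv₂ : ηinv * η = 1)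
    (absη absinv : H →L[ℂ] H) (habs_pos : absη.IsPositive)
    (habs_sq : absη * absη = η * η)
    (habsinv₁ : absη * absinv = 1) (habsinv₂ : absinv * absη = 1)
    (S : H → H → ℂ) (hS : ∀ x y : H, S x y = ⟪x, absη y⟫_ℂ)
    (u : H →L[ℂ] H) (hu : u = absinv * η) :
    (∃ c C : ℝ, 0 < c ∧ 0 < C ∧
      ∀ x : H, c * ‖x‖ ^ 2 ≤ (S x x).re ∧ (S x x).re ≤ C * ‖x‖ ^ 2) ∧
    (∀ x y : H, ⟪x, η y⟫_ℂ = S x (u y)) ∧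
    (∀ x y : H, S (u x) y = S x (u y)) ∧
    u * u = 1 := by
  have h0 : (0 : H →L[ℂ] H) ≤ absη := (ContinuousLinearMap.nonneg_iff_isPositive _).2 habs_pos
  have hcomm : absη * η = η * absη := by
    have h1 : CFC.sqrt (η * η) = absη := CFC.sqrt_unique habs_sq h0
    have h2 : Commute (η * η) η := (Commute.refl η).mul_left (Commute.refl η)
    have h3 : Commute (CFC.sqrt (η * η)) η := h2.cfcₙ_nnreal _
    rw [h1] at h3
    exact h3.eq
  have hcomm' : η * absinv = absinv * η := by
    calc η * absinv = (absinv * absη) * η * absinv := by rw [habsinv₂, one_mul]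
      _ = absinv * (absη * η) * absinv := by simp only [mul_assoc]
      _ = absinv * η * (absη * absinv) := by rw [hcomm]; simp only [mul_assoc]
      _ = absinv * η := by rw [habsinv₁, mul_one]
  have hAu : absη * u = η := by rw [hu, ← mul_assoc, habsinv₁, one_mul]
  have hAu' : ∀ x, absη (u x) = η x := fun x => by
    rw [← hAu]; rfl
  have hAsa : ∀ x y, ⟪absη x, y⟫_ℂ = ⟪x, absη y⟫_ℂ := habs_pos.isSymmetric
  have hηsa : ∀ x y, ⟪η x, y⟫_ℂ = ⟪x, η y⟫_ℂ := hη.isSymmetric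
  refine ⟨?_, ?_, ?_, ?_⟩
  · obtain ⟨R, hR0, hRR⟩ : ∃ R : H →L[ℂ] H, 0 ≤ R ∧ R * R = absη :=
      ⟨CFC.sqrt absη, CFC.sqrt_nonneg _, CFC.sqrt_mul_sqrt_self _ h0⟩
    have hRsa : ∀ x y, ⟪R x, y⟫_ℂ = ⟪x, R y⟫_ℂ :=
      ((ContinuousLinearMap.nonneg_iff_isPositive _).1 hR0).isSymmetric
    have hSx : ∀ x, (S x x).re = ‖R x‖ ^ 2 := fun x => by
      have h1 : absη x = R (R x) := by rw [← hRR]; rfl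
      rw [hS, h1, ← hRsa, inner_self_eq_norm_sq_to_K]
      norm_cast
    have hKpos : 0 < ‖absinv * R‖ + 1 := by positivity
    have hLpos : 0 < ‖R‖ + 1 := by positivity
    refine ⟨((‖absinv * R‖ + 1) ^ 2)⁻¹, (‖R‖ + 1) ^ 2, by positivity, by positivity, fun x => ?_⟩
    rw [hSx]
    constructor
    · rw [inv_mul_le_iff₀ (by positivity), ← mul_pow]
      have h1 : (absinv * R) (R x) = x := by
        have : (absinv * R) * R = 1 := by rw [mul_assoc, hRR, habsinv₂]
        exact congrArg (fun T : H →L[ℂ] H => T x) this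
      have h2 := (absinv * R).le_opNorm (R x)
      rw [h1] at h2
      gcongr
      nlinarith [norm_nonneg (R x)]
    · rw [← mul_pow]
      have h2 := R.le_opNorm x
      gcongr
      nlinarith [norm_nonneg x]
  · intro x y
    rw [hS, hAu']
  · intro x y
    rw [hS, hS, hAu', ← hAsa, hAu', hηsa]
  · calc u * u = absinv * (η * absinv) * η := by rw [hu]; simp only [mul_assoc]
      _ = absinv * absinv * (η * η) := by rw [hcomm']; simp only [mul_assoc]
      _ = absinv * (absinv * absη) * absη := by rw [← habs_sq]; simp only [mul_assoc]
      _ = 1 := by rw [habsinv₂, mul_one, habsinv₂]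
end

section
/- Let f : ℝ⁴ → ℂ be a twice continuously differentiable function satisfying, for all μ, ν ∈ {0,1,2,3} and all x ∈ ℝ⁴, the Lorentz-covariant system ∂_μ∂_ν f(x) = g_{μν}·□f(x), where g = diag(1,−1,−1,−1) and □f = ∂₀²f − ∂₁²f − ∂₂²f − ∂₃²f. Then □f(x) = 0 and all second partial derivatives ∂_μ∂_ν f(x) vanish for every x ∈ ℝ⁴; consequently f is affine: there exists a ℂ-linear map l : ℝ⁴ → ℂ such that f(x) = f(0) + l(x) for all x ∈ ℝ⁴. -/
/-- Partial derivative in the `μ`-th coordinate direction on `ℝ⁴`, for ℂ-valued maps. -/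
noncomputable def pderiv4C (μ : Fin 4) (f : (Fin 4 → ℝ) → ℂ) : (Fin 4 → ℝ) → ℂ :=
  fun x => fderiv ℝ f x (Pi.single μ 1)

/-- The Minkowski metric `g = diag(1,−1,−1,−1)` on `ℝ⁴`. -/
def minkowskiG (μ ν : Fin 4) : ℝ :=
  if μ = ν then (if μ = 0 then 1 else -1) else 0

/-- The Lorentz-covariant system `∂_μ∂_ν f = g_{μν} □f` (arising in Strocchi's first
no-go theorem) forces `□f = 0`, all second partial derivatives to vanish, and hence
`f` to be affine. -/
theorem stmt_15 (f : (Fin 4 → ℝ) → ℂ) (hf : ContDiff ℝ 2 f)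
    (box : (Fin 4 → ℝ) → ℂ)
    (hbox : box = fun x => pderiv4C 0 (pderiv4C 0 f) x - pderiv4C 1 (pderiv4C 1 f) x
      - pderiv4C 2 (pderiv4C 2 f) x - pderiv4C 3 (pderiv4C 3 f) x)
    (heq : ∀ (μ ν : Fin 4) (x : Fin 4 → ℝ),
      pderiv4C μ (pderiv4C ν f) x = (minkowskiG μ ν : ℂ) * box x) :
    (∀ x : Fin 4 → ℝ, box x = 0) ∧
    (∀ (μ ν : Fin 4) (x : Fin 4 → ℝ), pderiv4C μ (pderiv4C ν f) x = 0) ∧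
    (∃ l : (Fin 4 → ℝ) →ₗ[ℝ] ℂ, ∀ x : Fin 4 → ℝ, f x = f 0 + l x) := by
  have hb : ∀ x : Fin 4 → ℝ, box x = 0 := by
    intro x
    have h := congrFun hbox x
    simp only [heq] at h
    simp [minkowskiG] at h
    linear_combination (1 / 3 : ℂ) * h
  have h2 : ∀ (μ ν : Fin 4) (x : Fin 4 → ℝ), pderiv4C μ (pderiv4C ν f) x = 0 := by
    intro μ ν x
    rw [heq, hb, mul_zero]
  refine ⟨hb, h2, (fderiv ℝ f 0).toLinearMap, ?_⟩
  have hext : ∀ A B : (Fin 4 → ℝ) →L[ℝ] ℂ,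
      (∀ μ, A (Pi.single μ 1) = B (Pi.single μ 1)) → A = B := by
    intro A B h
    apply ContinuousLinearMap.coe_injective
    apply (Pi.basisFun ℝ (Fin 4)).ext
    intro μ
    simpa using h μ
  have hfd : Differentiable ℝ f := hf.differentiable (by norm_num)
  have hf1 : ContDiff ℝ 1 (fderiv ℝ f) := hf.fderiv_right (by norm_num)
  have hp : ∀ ν, Differentiable ℝ (pderiv4C ν f) := by
    intro ν
    exact (hf1.differentiable (by norm_num)).clm_apply (differentiable_const _)
  have hc : ∀ x, fderiv ℝ f x = fderiv ℝ f 0 := by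
    intro x
    apply hext
    intro ν
    refine is_const_of_fderiv_eq_zero (𝕜 := ℝ) (hp ν) ?_ x 0
    intro y
    apply hext
    intro μ
    exact h2 μ ν y
  intro x
  have hg : Differentiable ℝ (fun y => f y - fderiv ℝ f 0 y) :=
    hfd.sub (fderiv ℝ f 0).differentiable
  have := is_const_of_fderiv_eq_zero (𝕜 := ℝ) hg (by
    intro y
    rw [fderiv_fun_sub (hfd y) (fderiv ℝ f 0).differentiableAt, hc y,
      ContinuousLinearMap.fderiv, sub_self]) x 0
  simp only [map_zero, sub_zero] at this
  simp only [ContinuousLinearMap.coe_coe]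
  linear_combination this
end

section
/- Let f : ℝ⁴ → ℂ be a Schwartz function, and let □f := ∂₀²f − ∂₁²f − ∂₂²f − ∂₃²f (again a Schwartz function). Let 𝓕 denote the Fourier transform on ℝ⁴, 𝓕g(p) = ∫_{ℝ⁴} e^{−2πi⟨x,p⟩} g(x) dx with the Euclidean pairing ⟨·,·⟩, and identify ℝ⁴ = ℝ × ℝ³. Then the function k ↦ 𝓕(□f)(‖k‖, k) / (2‖k‖) is Lebesgue-integrable on ℝ³ ∖ {0} and ∫_{ℝ³} 𝓕(□f)(‖k‖, k) / (2‖k‖) dk = 0. In other words, the tempered distribution D⁺ defined by D⁺(g) := ∫_{ℝ³} 𝓕g(‖k‖,k)/(2‖k‖) dk (the inverse Fourier transform of the Lorentz-invariant measure θ(p⁰)δ(p·p) on the forward light cone) is a weak solution of the wave equation □D⁺ = 0. -/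
open MeasureTheory
open scoped FourierTransform

/-- Partial derivative in the `μ`-th coordinate direction on `ℝ⁴ = EuclideanSpace ℝ (Fin 4)`,
for ℂ-valued maps. -/
noncomputable def pderivE (μ : Fin 4) (f : EuclideanSpace ℝ (Fin 4) → ℂ) :
    EuclideanSpace ℝ (Fin 4) → ℂ :=
  fun x => fderiv ℝ f x (EuclideanSpace.single μ 1)

/-- The embedding `k ↦ (‖k‖, k)` of `ℝ³` onto the forward light cone in `ℝ⁴`. -/
noncomputable def lightConeEmb (k : EuclideanSpace ℝ (Fin 3)) : EuclideanSpace ℝ (Fin 4) :=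
  (EuclideanSpace.equiv (Fin 4) ℝ).symm ![‖k‖, k 0, k 1, k 2]

theorem pderivE_schwartz (μ : Fin 4) (f : SchwartzMap (EuclideanSpace ℝ (Fin 4)) ℂ) :
    pderivE μ f = (LineDeriv.lineDerivOp (EuclideanSpace.single μ (1 : ℝ)) f :
      SchwartzMap (EuclideanSpace ℝ (Fin 4)) ℂ) := by
  ext x
  rw [SchwartzMap.lineDerivOp_apply_eq_fderiv]
  rfl

theorem fourier_lineDeriv_two (μ : Fin 4) (f : SchwartzMap (EuclideanSpace ℝ (Fin 4)) ℂ)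
    (p : EuclideanSpace ℝ (Fin 4)) :
    𝓕 (LineDeriv.lineDerivOp (EuclideanSpace.single μ (1 : ℝ))
      (LineDeriv.lineDerivOp (EuclideanSpace.single μ (1 : ℝ)) f)) p
      = (2 * Real.pi * Complex.I) ^ 2 * (p μ : ℂ) ^ 2 * 𝓕 f p := by
  have hg : (fun x => inner ℝ x (EuclideanSpace.single μ (1 : ℝ)) :
      EuclideanSpace ℝ (Fin 4) → ℝ).HasTemperateGrowth := by fun_prop
  rw [SchwartzMap.fourier_lineDerivOp_eq, SchwartzMap.fourier_lineDerivOp_eq]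
  have hi : inner ℝ p (EuclideanSpace.single μ (1 : ℝ)) = p μ := by
    rw [EuclideanSpace.inner_single_right]
    simp
  simp [SchwartzMap.smulLeftCLM_apply_apply hg, hi]
  ring

/-- The massless two-point distribution `D⁺`, the inverse Fourier transform of the
Lorentz-invariant measure `θ(p⁰)δ(p·p)` on the forward light cone, is a weak solution of
the wave equation: for every Schwartz function `f`, the function
`k ↦ 𝓕(□f)(‖k‖,k)/(2‖k‖)` is integrable on `ℝ³` and its integral vanishes. -/
theorem stmt_17 (f : SchwartzMap (EuclideanSpace ℝ (Fin 4)) ℂ)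
    (boxf : EuclideanSpace ℝ (Fin 4) → ℂ)
    (hbox : boxf = fun x => pderivE 0 (pderivE 0 f) x - pderivE 1 (pderivE 1 f) x
      - pderivE 2 (pderivE 2 f) x - pderivE 3 (pderivE 3 f) x) :
    Integrable (fun k : EuclideanSpace ℝ (Fin 3) =>
      𝓕 boxf (lightConeEmb k) / (2 * (‖k‖ : ℂ))) ∧
    ∫ k : EuclideanSpace ℝ (Fin 3), 𝓕 boxf (lightConeEmb k) / (2 * (‖k‖ : ℂ)) = 0 := by
  set D : Fin 4 → SchwartzMap (EuclideanSpace ℝ (Fin 4)) ℂ := fun μ =>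
    LineDeriv.lineDerivOp (EuclideanSpace.single μ (1 : ℝ))
      (LineDeriv.lineDerivOp (EuclideanSpace.single μ (1 : ℝ)) f) with hD
  have hb : boxf = (D 0 - D 1 - D 2 - D 3 : SchwartzMap (EuclideanSpace ℝ (Fin 4)) ℂ) := by
    rw [hbox]
    ext x
    simp only [pderivE_schwartz, hD, SchwartzMap.sub_apply]
  have hz : ∀ k : EuclideanSpace ℝ (Fin 3), 𝓕 boxf (lightConeEmb k) = 0 := by
    intro k
    have hk : (‖k‖ : ℂ) ^ 2 = (k 0 : ℂ) ^ 2 + (k 1 : ℂ) ^ 2 + (k 2 : ℂ) ^ 2 := by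
      have h := EuclideanSpace.real_norm_sq_eq k
      rw [Fin.sum_univ_three] at h
      exact_mod_cast h
    have hs : 𝓕 (D 0 - D 1 - D 2 - D 3) = 𝓕 (D 0) - 𝓕 (D 1) - 𝓕 (D 2) - 𝓕 (D 3) := by
      simp only [sub_eq_add_neg, FourierTransform.fourier_add, FourierTransform.fourier_neg]
    rw [hb, ← SchwartzMap.fourier_coe, hs]
    simp only [SchwartzMap.sub_apply, hD, fourier_lineDeriv_two]
    have h0 : lightConeEmb k 0 = ‖k‖ := rfl
    have h1 : lightConeEmb k 1 = k 0 := rfl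
    have h2 : lightConeEmb k 2 = k 1 := rfl
    have h3 : lightConeEmb k 3 = k 2 := rfl
    rw [h0, h1, h2, h3, hk]
    ring
  simp [hz]
end
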